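/- Let ρ be a quantum state on ℂ^d (positive semidefinite with trace 1) and let Π₁, …, Π_N be orthogonal projections on ℂ^d. Then Tr{ρ} − Tr{ Π₁ ⋯ Π_N ⋯ Π₁ ρ Π₁ ⋯ Π_N ⋯ Π₁ } ≤ 2·√( 2 · Σ_{i=1}^{N} Tr{(I − Π_i) ρ} ); that is, performing the projections Π₁ through Π_N and then performing them again in the opposite order increases the failure probability bound only by a factor of √2 compared with Sen's bound for the single forward sequence. -/

import Mathlib

open Matrix ComplexOrder

lemma fb_trace_nonneg {d : ℕ} {ρ : Matrix (Fin d) (Fin d) ℂ} (hρ : ρ.PosSemidef)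
    (C : Matrix (Fin d) (Fin d) ℂ) : 0 ≤ (C * ρ * Cᴴ).trace.re := by
  have h := (hρ.mul_mul_conjTranspose_same C).trace_nonneg
  exact (Complex.le_def.1 h).1

lemma fb_proj_trace {d : ℕ} {Q : Matrix (Fin d) (Fin d) ℂ} (hQ : Q.IsHermitian)
    (hQQ : Q * Q = Q) (Y : Matrix (Fin d) (Fin d) ℂ) :
    (Q * Y * Qᴴ).trace = (Q * Y).trace := by
  rw [Matrix.trace_mul_comm, hQ.eq, ← Matrix.mul_assoc, hQQ]

lemma fb_compl {d : ℕ} {Q : Matrix (Fin d) (Fin d) ℂ} (hQ : Q.IsHermitian)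
    (hQQ : Q * Q = Q) : (1 - Q).IsHermitian ∧ (1 - Q) * (1 - Q) = 1 - Q :=
  ⟨Matrix.isHermitian_one.sub hQ, by simp [mul_sub, sub_mul, hQQ]⟩

lemma fb_fail_nonneg {d : ℕ} {ρ : Matrix (Fin d) (Fin d) ℂ} (hρ : ρ.PosSemidef)
    {Q : Matrix (Fin d) (Fin d) ℂ} (hQ : Q.IsHermitian)
    (hQQ : Q * Q = Q) : 0 ≤ ((1 - Q) * ρ).trace.re := by
  obtain ⟨h1, h2⟩ := fb_compl hQ hQQ
  rw [← fb_proj_trace h1 h2]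
  exact fb_trace_nonneg hρ _

lemma fb_step {d : ℕ} {ρ : Matrix (Fin d) (Fin d) ℂ} (hρ : ρ.PosSemidef)
    {Q : Matrix (Fin d) (Fin d) ℂ} (hQ : Q.IsHermitian)
    (hQQ : Q * Q = Q) (B : Matrix (Fin d) (Fin d) ℂ) :
    ((1 - Q * B) * ρ * (1 - Q * B)ᴴ).trace.re
      ≤ ((1 - Q) * ρ).trace.re + ((1 - B) * ρ * (1 - B)ᴴ).trace.re := by
  obtain ⟨h1, h2⟩ := fb_compl hQ hQQ
  have e : 1 - Q * B = (1 - Q) + Q * (1 - B) := by noncomm_ring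
  have z1 : Q * (1 - Q) = 0 := by rw [mul_sub, hQQ]; simp
  have z2 : (1 - Q) * Q = 0 := by rw [sub_mul, hQQ]; simp
  have hY := hρ.mul_mul_conjTranspose_same (1 - B)
  have k := fb_fail_nonneg hY hQ hQQ
  have key : ((1 - Q * B) * ρ * (1 - Q * B)ᴴ).trace
      = ((1 - Q) * ρ).trace + (Q * ((1 - B) * ρ * (1 - B)ᴴ)).trace := by
    rw [e, conjTranspose_add, conjTranspose_mul, h1.eq, hQ.eq]
    generalize 1 - B = C
    have a1 : ((1 - Q) * ρ * (1 - Q)).trace = ((1 - Q) * ρ).trace := by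
      rw [← fb_proj_trace h1 h2, h1.eq]
    have a2 : (Q * (C * ρ * Cᴴ) * Q).trace = (Q * (C * ρ * Cᴴ)).trace := by
      rw [← fb_proj_trace hQ hQQ (C * ρ * Cᴴ), hQ.eq]
    have a3 : ((1 - Q) * ρ * (Cᴴ * Q)).trace = 0 := by
      rw [Matrix.mul_assoc, Matrix.trace_mul_comm]
      simp only [Matrix.mul_assoc, z1, Matrix.mul_zero, Matrix.trace_zero]
    have a4 : (Q * C * ρ * (1 - Q)).trace = 0 := by
      rw [Matrix.trace_mul_comm]
      simp only [← Matrix.mul_assoc, z2, Matrix.zero_mul, Matrix.trace_zero]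
    have a5 : Q * C * ρ * (Cᴴ * Q) = Q * (C * ρ * Cᴴ) * Q := by
      simp only [Matrix.mul_assoc]
    rw [add_mul, mul_add, add_mul, add_mul, Matrix.trace_add, Matrix.trace_add, Matrix.trace_add,
      a1, a3, a4, a5, a2]
    ring
  rw [key, Complex.add_re]
  rw [sub_mul, one_mul, Matrix.trace_sub, Complex.sub_re] at k
  linarith

lemma fb_list {d : ℕ} {ρ : Matrix (Fin d) (Fin d) ℂ} (hρ : ρ.PosSemidef)
    (L : List (Matrix (Fin d) (Fin d) ℂ))
    (hL : ∀ Q ∈ L, Q.IsHermitian ∧ Q * Q = Q) :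
    ((1 - L.prod) * ρ * (1 - L.prod)ᴴ).trace.re
      ≤ (L.map fun Q => ((1 - Q) * ρ).trace.re).sum := by
  induction L with
  | nil => simp
  | cons Q L ih =>
    have h := hL Q (by simp)
    have i := ih fun R hR => hL R (by simp [hR])
    have s := fb_step hρ h.1 h.2 L.prod
    simp only [List.prod_cons, List.map_cons, List.sum_cons]
    linarith

lemma fb_gentle {d : ℕ} {ρ : Matrix (Fin d) (Fin d) ℂ} (hρ : ρ.PosSemidef)
    (htr : ρ.trace = 1) (B : Matrix (Fin d) (Fin d) ℂ) :
    ρ.trace.re - (B * ρ * Bᴴ).trace.re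
      ≤ 2 * Real.sqrt ((1 - B) * ρ * (1 - B)ᴴ).trace.re := by
  have expand : ∀ (C : Matrix (Fin d) (Fin d) ℂ) (t : ℝ),
      (((t : ℂ) • 1 - C) * ρ * ((t : ℂ) • 1 - C)ᴴ).trace.re
        = t ^ 2 - 2 * t * (C * ρ).trace.re + (C * ρ * Cᴴ).trace.re := by
    intro C t
    have c : (ρ * Cᴴ).trace.re = (C * ρ).trace.re := by
      have : ρ * Cᴴ = (C * ρ)ᴴ := by rw [conjTranspose_mul, hρ.1.eq]
      rw [this, trace_conjTranspose]; simp
    have : (((t : ℂ) • 1 - C) * ρ * ((t : ℂ) • 1 - C)ᴴ)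
        = ((t : ℂ) * t) • ρ - (t : ℂ) • (ρ * Cᴴ) - (t : ℂ) • (C * ρ) + C * ρ * Cᴴ := by
      simp only [conjTranspose_sub, conjTranspose_smul, conjTranspose_one, sub_mul, mul_sub,
        smul_mul_assoc, mul_smul_comm, one_mul, mul_one, smul_sub, mul_smul, Complex.star_def,
        Complex.conj_ofReal]
      abel
    rw [this]
    simp only [trace_add, trace_sub, trace_smul, htr, Complex.add_re, Complex.sub_re, smul_eq_mul,
      Complex.re_ofReal_mul, c, mul_one, Complex.mul_re, Complex.ofReal_re, Complex.ofReal_im]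
    ring
  have h1 := expand (1 - B) 1
  have h2 := expand (1 - B) ((1 - B) * ρ).trace.re
  have h3 := fb_trace_nonneg hρ ((((1 - B) * ρ).trace.re : ℂ) • 1 - (1 - B))
  have h4 := fb_trace_nonneg hρ (1 - B)
  rw [h2] at h3
  have h5 : ((1 - B) * ρ).trace.re ≤ Real.sqrt ((1 - B) * ρ * (1 - B)ᴴ).trace.re :=
    Real.le_sqrt_of_sq_le (by linarith)
  rw [Complex.ofReal_one, one_smul, sub_sub_cancel] at h1
  rw [h1, htr, Complex.one_re]
  linarith

lemma fb_palindrome {α : Type*} (l : List α) :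
    (l ++ l.reverse.tail).reverse = l ++ l.reverse.tail := by
  rcases List.eq_nil_or_concat l with rfl | ⟨l, a, rfl⟩ <;> simp

/-- **Sen's bound for a forward-then-backward sequence of projections.**
For a quantum state `ρ` and orthogonal projections `Π₁, …, Π_N` on `ℂ^d`, with
`B = Π₁ Π₂ ⋯ Π_{N−1} Π_N Π_{N−1} ⋯ Π₂ Π₁` (the forward sequence followed by the reverse
sequence, coded as the product over the palindromic list `[Π₁, …, Π_N, Π_{N−1}, …, Π₁]`),
`Tr ρ − Tr (B ρ B) ≤ 2 √(2 ∑ᵢ Tr ((I − Πᵢ) ρ))`. -/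
theorem forward_backward_union_bound {d N : ℕ}
    (ρ : Matrix (Fin d) (Fin d) ℂ) (hρ : ρ.PosSemidef) (hρtr : ρ.trace = 1)
    (P : Fin N → Matrix (Fin d) (Fin d) ℂ)
    (hherm : ∀ i, (P i).IsHermitian) (hproj : ∀ i, P i * P i = P i) :
    ρ.trace.re -
        ((List.ofFn P ++ (List.ofFn P).reverse.tail).prod * ρ *
          (List.ofFn P ++ (List.ofFn P).reverse.tail).prod).trace.re
      ≤ 2 * Real.sqrt (2 * ∑ i, (((1 : Matrix (Fin d) (Fin d) ℂ) - P i) * ρ).trace.re) := by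
  have hmem : ∀ Q ∈ List.ofFn P ++ (List.ofFn P).reverse.tail, Q.IsHermitian ∧ Q * Q = Q := by
    intro Q hQ
    have : Q ∈ List.ofFn P := by
      rcases List.mem_append.1 hQ with h | h
      · exact h
      · exact List.mem_reverse.1 (List.mem_of_mem_tail h)
    obtain ⟨i, rfl⟩ := (List.mem_ofFn' P Q).1 this
    exact ⟨hherm i, hproj i⟩
  have hB : ((List.ofFn P ++ (List.ofFn P).reverse.tail).prod)ᴴ
      = (List.ofFn P ++ (List.ofFn P).reverse.tail).prod := by
    rw [conjTranspose_list_prod, List.map_congr_left (g := id) fun Q hQ => (hmem Q hQ).1.eq,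
      List.map_id, fb_palindrome]
  have h1 := fb_gentle hρ hρtr (List.ofFn P ++ (List.ofFn P).reverse.tail).prod
  have h2 := fb_list hρ _ hmem
  rw [hB] at h1
  refine h1.trans ?_
  gcongr
  refine h2.trans ?_
  rw [List.map_append, List.sum_append, two_mul]
  have hs : ((List.ofFn P).map fun Q => ((1 - Q) * ρ).trace.re).sum
      = ∑ i, ((1 - P i) * ρ).trace.re := by
    rw [List.map_ofFn, List.sum_ofFn]; rfl
  have ht : ((List.ofFn P).reverse.tail.map fun Q => ((1 - Q) * ρ).trace.re).sum
      ≤ ((List.ofFn P).map fun Q => ((1 - Q) * ρ).trace.re).sum := by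
    rw [← List.sum_reverse ((List.ofFn P).map _), ← List.map_reverse]
    have hm : ∀ Q ∈ (List.ofFn P).reverse, 0 ≤ ((1 - Q) * ρ).trace.re := by
      intro Q hQ
      have h := hmem Q (List.mem_append_left _ (List.mem_reverse.1 hQ))
      exact fb_fail_nonneg hρ h.1 h.2
    generalize (List.ofFn P).reverse = L at hm
    cases L with
    | nil => simp
    | cons a L =>
      have := hm a (by simp)
      simp only [List.tail_cons, List.map_cons, List.sum_cons]
      linarith
  linarith
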